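/- If the vector field E(x) = ik ∫ Φ_k(x,y) J(y) dy where Φ_k(x,y) = e^{ik|x−y|}/(4π|x−y|), and J is a continuous compactly supported vector field with ∫ J(y)·∇(∇·φ)(y) dy = 0 for all smooth compactly supported vector fields φ, then ∫ E(x)·∇(∇·φ)(x) dx = 0 for all smooth compactly supported vector fields φ; i.e., E inherits the weak divergence-free property of J. -/

import Mathlib

open MeasureTheory

/-- `∇(∇·φ)` for a vector field `φ` on `ℝ³`. -/
noncomputable def gradDiv (φ : EuclideanSpace ℝ (Fin 3) → Fin 3 → ℝ)
    (x : EuclideanSpace ℝ (Fin 3)) (i : Fin 3) : ℝ :=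
  fderiv ℝ (fun y => ∑ j : Fin 3,
      fderiv ℝ (fun z => φ z j) y (EuclideanSpace.single j 1)) x
    (EuclideanSpace.single i 1)

/-- The fundamental solution of the 3D Helmholtz equation. -/
noncomputable def PhiK (k : ℝ) (x y : EuclideanSpace ℝ (Fin 3)) : ℂ :=
  Complex.exp (Complex.I * k * ‖x - y‖) / (4 * Real.pi * ‖x - y‖)

/-- The fundamental solution is integrable on balls: its singularity at the origin is of order
`1 / ‖z‖`, which is integrable in dimension three. -/
lemma integrableOn_ball_PhiK_zero (k r : ℝ) :
    IntegrableOn (fun z => PhiK k z 0) (Metric.ball (0 : EuclideanSpace ℝ (Fin 3)) r) := by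
  have h := (integrableOn_fun_norm_addHaar (volume : Measure (EuclideanSpace ℝ (Fin 3)))
    (f := fun t : ℝ => Complex.exp (Complex.I * k * t) / (4 * Real.pi * t)) (r := r)).2 ?_
  · simpa only [PhiK, sub_zero] using h
  · have hc : IntegrableOn (fun t : ℝ => (t : ℂ) * Complex.exp (Complex.I * k * t) / (4 * Real.pi))
        (Set.Ioo 0 r) :=
      ((by fun_prop : Continuous fun t : ℝ =>
        (t : ℂ) * Complex.exp (Complex.I * k * t) / (4 * Real.pi)).integrableOn_Icc
          (a := 0) (b := r)).mono_set Set.Ioo_subset_Icc_self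
    refine hc.congr_fun (fun t ht => ?_) measurableSet_Ioo
    have ht0 : (t : ℂ) ≠ 0 := by exact_mod_cast ht.1.ne'
    have hpi : (Real.pi : ℂ) ≠ 0 := by exact_mod_cast Real.pi_ne_zero
    simp only [finrank_euclideanSpace, Fintype.card_fin, Complex.real_smul]
    push_cast
    field_simp

lemma PhiK_sub_right (k : ℝ) (x z : EuclideanSpace ℝ (Fin 3)) :
    PhiK k x (x - z) = PhiK k z 0 := by
  simp [PhiK]

section GradDiv

variable {φ : EuclideanSpace ℝ (Fin 3) → Fin 3 → ℝ}

lemma continuous_gradDiv (hφ : ContDiff ℝ (⊤ : ℕ∞) φ) (i : Fin 3) :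
    Continuous fun x => gradDiv φ x i := by
  have hdiv : ContDiff ℝ 1 fun y => ∑ j : Fin 3,
      fderiv ℝ (fun z => φ z j) y (EuclideanSpace.single j 1) := by
    refine ContDiff.sum fun j _ => ?_
    have hj : ContDiff ℝ 2 fun z => φ z j :=
      (contDiff_pi.1 hφ j).of_le (WithTop.coe_le_coe.2 (le_top : (2 : ℕ∞) ≤ ⊤))
    exact (hj.fderiv_right (m := 1) (by norm_num)).clm_apply contDiff_const
  exact (hdiv.continuous_fderiv one_ne_zero).clm_apply continuous_const

lemma hasCompactSupport_gradDiv (hφ : HasCompactSupport φ) (i : Fin 3) :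
    HasCompactSupport fun x => gradDiv φ x i := by
  refine HasCompactSupport.fderiv_apply (𝕜 := ℝ) ?_ _
  refine hφ.of_isClosed_subset (isClosed_tsupport _) (closure_minimal ?_ (isClosed_tsupport _))
  intro y hy
  by_contra h
  refine hy (Finset.sum_eq_zero fun j _ => ?_)
  have hj : y ∉ tsupport fun z => φ z j := fun hy' =>
    h (tsupport_comp_subset (g := fun v : Fin 3 → ℝ => v j) rfl φ hy')
  rw [fderiv_of_notMem_tsupport (𝕜 := ℝ) hj, zero_apply]

lemma gradDiv_comp_add_right (a x : EuclideanSpace ℝ (Fin 3)) (i : Fin 3) :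
    gradDiv (fun y => φ (y + a)) x i = gradDiv φ (x + a) i := by
  have h (j : Fin 3) (y : EuclideanSpace ℝ (Fin 3)) :
      fderiv ℝ (fun z => φ (z + a) j) y = fderiv ℝ (fun z => φ z j) (y + a) :=
    fderiv_comp_add_right (f := fun z => φ z j) a
  simp only [gradDiv, h]
  rw [fderiv_comp_add_right (f := fun y => ∑ j : Fin 3,
      fderiv ℝ (fun z => φ z j) y (EuclideanSpace.single j 1)) a]

end GradDiv

/-- The integrand of a convolution, tested against `g`, is integrable on the product as soon as
the kernel `f` is integrable on balls and `u`, `g` are continuous with compact support. -/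
lemma integrable_prod_mul_sub_mul {V : Type*} [NormedAddCommGroup V] [MeasurableSpace V]
    [BorelSpace V] [SecondCountableTopology V] {μ : Measure V} [IsFiniteMeasureOnCompacts μ]
    [SFinite μ] {f u g : V → ℂ} (hf : ∀ r, IntegrableOn f (Metric.ball 0 r) μ)
    (hu : Continuous u) (hus : HasCompactSupport u)
    (hg : Continuous g) (hgs : HasCompactSupport g) :
    Integrable (fun p : V × V => f p.2 * (u (p.1 - p.2) * g p.1)) (μ.prod μ) := by
  obtain ⟨r, hr⟩ := ((hgs.isCompact.prod hus.isCompact).image continuous_sub).isBounded.subset_ball 0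
  obtain ⟨C, hC⟩ := hu.bounded_above_of_compact_support hus
  have hprod : Integrable (fun p : V × V => g p.1 * (Metric.ball 0 r).indicator f p.2)
      (μ.prod μ) :=
    (hg.integrable_of_hasCompactSupport hgs).mul_prod
      ((hf r).integrable_indicator Metric.isOpen_ball.measurableSet)
  refine (hprod.bdd_mul (f := fun p : V × V => u (p.1 - p.2)) (c := C)
    (hu.comp (continuous_fst.sub continuous_snd)).aestronglyMeasurable
    (Filter.Eventually.of_forall fun p => hC _)).congr (Filter.Eventually.of_forall fun p => ?_)
  by_cases hp : p.2 ∈ Metric.ball 0 r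
  · simp only [Set.indicator_of_mem hp]
    ring
  · have h0 : u (p.1 - p.2) * g p.1 = 0 := by
      by_contra h
      obtain ⟨h1, h2⟩ := mul_ne_zero_iff.1 h
      exact hp (hr ⟨(p.1, p.1 - p.2), ⟨subset_tsupport _ h2, subset_tsupport _ h1⟩, by simp⟩)
    simp [Set.indicator_of_notMem hp, h0]

/-- If `E(x) = ik ∫ Φ_k(x,y) J(y) dy` with `J` continuous, compactly supported and
weakly divergence free, then `E` is also weakly divergence free:
`∫ E(x)·∇(∇·φ)(x) dx = 0` for all smooth compactly supported vector fields `φ`. -/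
theorem stmt_19 (k : ℝ) (hk : 0 < k)
    (J : EuclideanSpace ℝ (Fin 3) → Fin 3 → ℂ)
    (hJc : Continuous J) (hJs : HasCompactSupport J)
    (hJdiv : ∀ φ : EuclideanSpace ℝ (Fin 3) → Fin 3 → ℝ,
      ContDiff ℝ (⊤ : ℕ∞) φ → HasCompactSupport φ →
      (∫ y, ∑ i : Fin 3, J y i * (gradDiv φ y i : ℂ)) = 0)
    (E : EuclideanSpace ℝ (Fin 3) → Fin 3 → ℂ)
    (hE : ∀ x i, E x i = Complex.I * k * ∫ y, PhiK k x y * J y i) :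
    ∀ φ : EuclideanSpace ℝ (Fin 3) → Fin 3 → ℝ,
      ContDiff ℝ (⊤ : ℕ∞) φ → HasCompactSupport φ →
      (∫ x, ∑ i : Fin 3, E x i * (gradDiv φ x i : ℂ)) = 0 := by
  intro φ hφ hφs
  have hgc (i : Fin 3) : Continuous fun x => (gradDiv φ x i : ℂ) :=
    Complex.continuous_ofReal.comp (continuous_gradDiv hφ i)
  have hgs (i : Fin 3) : HasCompactSupport fun x => (gradDiv φ x i : ℂ) :=
    (hasCompactSupport_gradDiv hφs i).comp_left Complex.ofReal_zero
  have hJic (i : Fin 3) : Continuous fun y => J y i := (continuous_apply i).comp hJc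
  have hJis (i : Fin 3) : HasCompactSupport fun y => J y i :=
    hJs.comp_left (g := fun v : Fin 3 → ℂ => v i) rfl
  have hF (i : Fin 3) := integrable_prod_mul_sub_mul (μ := volume)
    (integrableOn_ball_PhiK_zero k) (hJic i) (hJis i) (hgc i) (hgs i)
  have hEconv (x : EuclideanSpace ℝ (Fin 3)) (i : Fin 3) : E x i * (gradDiv φ x i : ℂ) =
      Complex.I * k * ∫ z, PhiK k z 0 * (J (x - z) i * (gradDiv φ x i : ℂ)) := by
    rw [hE, ← integral_sub_left_eq_self (fun y => PhiK k x y * J y i) volume x, mul_assoc,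
      ← integral_mul_const]
    simp only [PhiK_sub_right, mul_assoc]
  have hweak (z : EuclideanSpace ℝ (Fin 3)) :
      ∫ x, ∑ i : Fin 3, J (x - z) i * (gradDiv φ x i : ℂ) = 0 := by
    rw [← integral_add_right_eq_self _ z]
    simp only [add_sub_cancel_right, ← gradDiv_comp_add_right]
    exact hJdiv _ (hφ.comp (contDiff_id.add contDiff_const))
      (hφs.comp_homeomorph (Homeomorph.addRight z))
  have hint (z : EuclideanSpace ℝ (Fin 3)) (i : Fin 3) :
      Integrable fun x => PhiK k z 0 * (J (x - z) i * (gradDiv φ x i : ℂ)) :=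
    ((((hJic i).comp (continuous_id.sub continuous_const)).mul
      (hgc i)).integrable_of_hasCompactSupport (hgs i).mul_left).const_mul _
  calc ∫ x, ∑ i : Fin 3, E x i * (gradDiv φ x i : ℂ)
      = ∑ i : Fin 3, Complex.I * k *
          ∫ x, ∫ z, PhiK k z 0 * (J (x - z) i * (gradDiv φ x i : ℂ)) := by
        simp only [hEconv]
        rw [integral_finsetSum _ fun i _ => (hF i).integral_prod_left.const_mul _]
        simp only [integral_const_mul]
    _ = Complex.I * k * ∑ i : Fin 3,
          ∫ z, ∫ x, PhiK k z 0 * (J (x - z) i * (gradDiv φ x i : ℂ)) := by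
        rw [Finset.mul_sum]
        exact Finset.sum_congr rfl fun i _ => by rw [integral_integral_swap (hF i)]
    _ = Complex.I * k * ∫ z, PhiK k z 0 *
          ∫ x, ∑ i : Fin 3, J (x - z) i * (gradDiv φ x i : ℂ) := by
        rw [← integral_finsetSum _ fun i _ => (hF i).integral_prod_right]
        congr 2 with z
        rw [← integral_finsetSum _ fun i _ => hint z i, ← integral_const_mul]
        simp only [Finset.mul_sum]
    _ = 0 := by simp only [hweak, mul_zero, integral_zero]
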